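/- (Łojasiewicz inequality.) Let V ⊆ ℝⁿ be open, let f : V → ℝ be real-analytic, let K ⊆ V be compact, and let Z = { x ∈ V : f(x) = 0 }. If Z is nonempty, then there exist constants C > 0 and r > 0 such that |f(y)| ≥ C · dist(y, Z)^r for all y ∈ K. -/

import Mathlib

noncomputable section

section

open Filter Topology Asymptotics

section

open Polynomial

theorem sum_powersetCard_prod_eq_filter {ι : Type*} [Fintype ι] (w : ι → ℂ) (j : ℕ) :
    ∑ S ∈ Finset.powersetCard j Finset.univ, ∏ i ∈ S, w i =
      ∑ S ∈ Finset.powersetCard j (Finset.univ.filter fun i => w i ≠ 0), ∏ i ∈ S, w i := by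
  symm
  apply Finset.sum_subset
  · exact Finset.powersetCard_mono (Finset.subset_univ _)
  · intro S hS hS'
    simp only [Finset.mem_powersetCard, Finset.subset_univ, true_and] at hS hS'
    have : ¬ S ⊆ Finset.univ.filter fun i => w i ≠ 0 := fun h => hS' ⟨h, hS⟩
    obtain ⟨i, hi, hi'⟩ := Finset.not_subset.1 this
    exact Finset.prod_eq_zero hi (by simpa using hi')

/-- If all elementary symmetric functions of degree larger than `m` vanish, then the one of
degree `m` is controlled by each nonzero entry. -/
theorem norm_sum_powersetCard_prod_le {ι : Type*} [Fintype ι] (w : ι → ℂ) {B : ℝ} (hB : 1 ≤ B)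
    (hw : ∀ i, ‖w i‖ ≤ B) {m : ℕ}
    (h : ∀ j, m < j → ∑ S ∈ Finset.powersetCard j Finset.univ, ∏ i ∈ S, w i = 0)
    {i : ι} (hi : w i ≠ 0) :
    ‖∑ S ∈ Finset.powersetCard m Finset.univ, ∏ i ∈ S, w i‖ ≤ ‖w i‖ * B ^ Fintype.card ι := by
  classical
  set T := Finset.univ.filter fun i => w i ≠ 0 with hT
  have hcard : T.card ≤ m := by
    by_contra! hlt
    have := h _ hlt
    rw [sum_powersetCard_prod_eq_filter, ← hT, Finset.powersetCard_self, Finset.sum_singleton,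
      Finset.prod_eq_zero_iff] at this
    obtain ⟨a, ha, ha'⟩ := this
    simp [hT] at ha
    exact ha ha'
  rw [sum_powersetCard_prod_eq_filter, ← hT]
  rcases hcard.lt_or_eq with hlt | rfl
  · rw [Finset.powersetCard_eq_empty.2 hlt]
    simp only [Finset.sum_empty, norm_zero]
    positivity
  · have hiT : i ∈ T := by simp [hT, hi]
    rw [Finset.powersetCard_self, Finset.sum_singleton, ← Finset.mul_prod_erase _ _ hiT, norm_mul,
      norm_prod]
    gcongr
    calc ∏ x ∈ T.erase i, ‖w x‖ ≤ ∏ x ∈ T.erase i, B :=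
          Finset.prod_le_prod (fun _ _ => norm_nonneg _) fun x _ => hw x
      _ ≤ B ^ Fintype.card ι := by
          rw [Finset.prod_const]
          exact pow_le_pow_right₀ hB (Finset.card_le_univ _)

/-- The elementary symmetric functions of the root differences of a monic polynomial are
polynomials in its coefficients. -/
theorem exists_mvPolynomial_eq_esymm_sub (d m : ℕ) :
    ∃ Q : MvPolynomial (Fin d) ℝ, ∀ (c : Fin d → ℝ) (t : Fin d → ℂ),
      (X ^ d + ∑ i, C (c i : ℂ) * X ^ (i : ℕ) : ℂ[X]) = ∏ i, (X - C (t i)) →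
      ((MvPolynomial.eval c Q : ℝ) : ℂ) =
        ∑ S ∈ Finset.powersetCard m (Finset.univ : Finset (Fin d × Fin d)),
          ∏ p ∈ S, (t p.1 - t p.2) := by
  let q : MvPolynomial (Fin d) ℝ :=
    MvPolynomial.aeval (fun p : Fin d × Fin d => (MvPolynomial.X p.1 - MvPolynomial.X p.2))
      (MvPolynomial.esymm (Fin d × Fin d) ℝ m)
  have hq : q.IsSymmetric := by
    intro e
    have h1 := MvPolynomial.rename_esymm (Fin d × Fin d) ℝ m (e.prodCongr e)
    simp only [q]
    conv_rhs => rw [← h1]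
    rw [MvPolynomial.aeval_rename, ← AlgHom.comp_apply, MvPolynomial.comp_aeval]
    simp [Function.comp_def]
  obtain ⟨R, hR⟩ := MvPolynomial.esymmAlgHom_fin_surjective ℝ (le_refl d) ⟨q, hq⟩
  have hR' := congrArg Subtype.val hR
  rw [MvPolynomial.esymmAlgHom_apply] at hR'
  refine ⟨MvPolynomial.aeval
    (fun i : Fin d => (-1 : MvPolynomial (Fin d) ℝ) ^ ((i : ℕ) + 1) * MvPolynomial.X i.rev) R, ?_⟩
  intro c t hct
  have key : ∀ i : Fin d, (((-1 : ℝ) ^ ((i : ℕ) + 1) * c i.rev : ℝ) : ℂ) =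
      MvPolynomial.aeval t (MvPolynomial.esymm (Fin d) ℝ ((i : ℕ) + 1)) := by
    intro i
    have h1 := congrArg (fun p => coeff p (i.rev : ℕ)) hct
    have h2 : (∏ i, (X - C (t i)) : ℂ[X]) =
        ((Multiset.map t Finset.univ.val).map fun a => X - C a).prod := by
      rw [Multiset.map_map]; rfl
    simp only [h2, coeff_add, coeff_X_pow, finsetSum_coeff, coeff_C_mul] at h1
    rw [Multiset.prod_X_sub_C_coeff _ (by simp [Fin.rev])] at h1
    have h3 : (i.rev : ℕ) ≠ d := i.rev.2.ne
    simp only [h3, if_false, zero_add, mul_ite, mul_one, mul_zero, Fin.val_inj,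
      Finset.sum_ite_eq, Finset.mem_univ, if_true] at h1
    have h4 : Multiset.card (Multiset.map t Finset.univ.val) - (i.rev : ℕ) = i + 1 := by
      have := i.2
      simp [Fin.val_rev]; omega
    rw [h4] at h1
    rw [MvPolynomial.aeval_esymm_eq_multiset_esymm]
    push_cast
    rw [h1, ← mul_assoc, ← mul_pow]
    simp
  have e1 : ((MvPolynomial.eval c (MvPolynomial.aeval
      (fun i : Fin d => (-1 : MvPolynomial (Fin d) ℝ) ^ ((i : ℕ) + 1) * MvPolynomial.X i.rev) R) :
      ℝ) : ℂ) = MvPolynomial.aeval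
        (fun i : Fin d => (((-1 : ℝ) ^ ((i : ℕ) + 1) * c i.rev : ℝ) : ℂ)) R := by
    have : ∀ x : MvPolynomial (Fin d) ℝ, ((MvPolynomial.eval c x : ℝ) : ℂ) =
        (Complex.ofRealAm.comp (MvPolynomial.aeval c)) x := fun x => by
      simp [MvPolynomial.aeval_eq_eval]
    rw [this, ← AlgHom.comp_apply, MvPolynomial.comp_aeval]
    congr 2
    ext i
    simp
  rw [e1]
  simp_rw [key]
  rw [← MvPolynomial.comp_aeval_apply, hR']
  simp only [q]
  rw [← AlgHom.comp_apply, MvPolynomial.comp_aeval, MvPolynomial.aeval_esymm_eq_multiset_esymm,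
    Finset.esymm_map_val]
  simp

theorem norm_le_of_pow_add_sum_eq_zero {d : ℕ} {c : Fin d → ℝ} (hc : ∀ i, |c i| ≤ 1) {z : ℂ}
    (hz : z ^ d + ∑ i, (c i : ℂ) * z ^ (i : ℕ) = 0) : ‖z‖ ≤ d + 1 := by
  by_contra! hlt
  have hz1 : 1 ≤ ‖z‖ := by
    have : (0 : ℝ) ≤ d := by positivity
    linarith
  rcases d with _ | d
  · simp at hz
  have h1 : ‖z‖ ^ (d + 1) ≤ (d + 1 : ℝ) * ‖z‖ ^ d := by
    rw [← norm_pow, eq_neg_of_add_eq_zero_left hz, norm_neg]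
    refine (norm_sum_le _ _).trans ?_
    calc ∑ i : Fin (d + 1), ‖(c i : ℂ) * z ^ (i : ℕ)‖ ≤ ∑ i : Fin (d + 1), ‖z‖ ^ d := by
          refine Finset.sum_le_sum fun i _ => ?_
          rw [norm_mul, norm_pow, Complex.norm_real, Real.norm_eq_abs]
          calc |c i| * ‖z‖ ^ (i : ℕ) ≤ 1 * ‖z‖ ^ d := by
                gcongr
                · exact hc i
                · omega
            _ = ‖z‖ ^ d := one_mul _
      _ = _ := by simp
  rw [pow_succ'] at h1
  have h2 : ‖z‖ ≤ d + 1 := le_of_mul_le_mul_right h1 (by positivity)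
  push_cast at hlt
  linarith

theorem exists_prod_X_sub_C {d : ℕ} (c : Fin d → ℝ) :
    ∃ t : Fin d → ℂ,
      (X ^ d + ∑ i, C (c i : ℂ) * X ^ (i : ℕ) : ℂ[X]) = ∏ i, (X - C (t i)) := by
  set p : ℂ[X] := X ^ d + ∑ i, C (c i : ℂ) * X ^ (i : ℕ) with hp
  have hdeg : (∑ i : Fin d, C (c i : ℂ) * X ^ (i : ℕ) : ℂ[X]).degree < d :=
    degree_sum_fin_lt fun i => (c i : ℂ)
  have hmonic : p.Monic := monic_X_pow_add hdeg
  have hnat : p.natDegree = d := natDegree_eq_of_degree_eq_some (by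
    rw [hp, degree_add_eq_left_of_degree_lt (by rwa [degree_X_pow]), degree_X_pow])
  have hsplit : p.Splits := IsAlgClosed.splits p
  have hcard : p.roots.card = d := by rw [← hnat]; exact (splits_iff_card_roots.1 hsplit)
  have hprod := hsplit.eq_prod_roots_of_monic hmonic
  obtain ⟨l, hl⟩ := Quot.exists_rep p.roots
  have hl' : (l : Multiset ℂ) = p.roots := hl
  have hlen : l.length = d := by rw [← hcard, ← hl', Multiset.coe_card]
  subst hlen
  refine ⟨fun i => l.get i, ?_⟩
  rw [hprod, ← hl', Multiset.map_coe, Multiset.prod_coe, ← List.prod_ofFn]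
  congr 1
  exact List.ext_getElem (by simp) (by simp)

/-- For a real monic polynomial of degree `d` all of whose invariants of index larger than `m`
vanish, a point where the polynomial is small is close to a real root, unless the invariant
of index `m` is small as well. -/
theorem exists_invariants_real_root (d : ℕ) :
    ∃ (E : ℕ → MvPolynomial (Fin d) ℝ) (M : ℕ) (K : ℝ),
      (∀ c, MvPolynomial.eval c (E 0) = 1) ∧ (∀ c, ∀ m > M, MvPolynomial.eval c (E m) = 0) ∧
      ∀ c : Fin d → ℝ, (∀ i, |c i| ≤ 1) → ∀ m, (∀ j > m, MvPolynomial.eval c (E j) = 0) →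
        ∀ x : ℝ, (∃ z : ℝ, z ^ d + ∑ i, c i * z ^ (i : ℕ) = 0 ∧
            |x - z| ^ d ≤ |x ^ d + ∑ i, c i * x ^ (i : ℕ)|) ∨
          |MvPolynomial.eval c (E m)| ^ d ≤ K * |x ^ d + ∑ i, c i * x ^ (i : ℕ)| := by
  choose Q hQ using exists_mvPolynomial_eq_esymm_sub d
  set B : ℝ := 2 * (d + 1) with hB
  have hB1 : 1 ≤ B := by
    have : (0 : ℝ) ≤ d := by positivity
    linarith
  refine ⟨Q, d * d, (2 * B ^ Fintype.card (Fin d × Fin d)) ^ d, ?_, ?_, ?_⟩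
  · intro c
    obtain ⟨t, ht⟩ := exists_prod_X_sub_C c
    have := hQ 0 c t ht
    simp only [Finset.powersetCard_zero, Finset.sum_singleton, Finset.prod_empty] at this
    exact_mod_cast this
  · intro c m hm
    obtain ⟨t, ht⟩ := exists_prod_X_sub_C c
    have := hQ m c t ht
    rw [Finset.powersetCard_eq_empty.2 (by simpa using hm), Finset.sum_empty] at this
    exact_mod_cast this
  · intro c hc m hm x
    obtain ⟨t, ht⟩ := exists_prod_X_sub_C c
    have hev : ∀ z : ℂ, z ^ d + ∑ i, (c i : ℂ) * z ^ (i : ℕ) = ∏ i, (z - t i) := fun z => by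
      simpa [eval_finsetSum, eval_prod] using congrArg (eval z) ht
    have hroot : ∀ i, t i ^ d + ∑ j, (c j : ℂ) * t i ^ (j : ℕ) = 0 := fun i => by
      rw [hev, Finset.prod_eq_zero (Finset.mem_univ i) (sub_self _)]
    have hle := fun i => norm_le_of_pow_add_sum_eq_zero hc (hroot i)
    have hprod : |x ^ d + ∑ i, c i * x ^ (i : ℕ)| = ∏ i, ‖(x : ℂ) - t i‖ := by
      rw [← norm_prod, ← hev, ← Real.norm_eq_abs, ← Complex.norm_real]
      push_cast
      rfl
    rcases Nat.eq_zero_or_pos d with rfl | hd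
    · right
      simp
    have : Nonempty (Fin d) := ⟨⟨0, hd⟩⟩
    obtain ⟨i, -, hi⟩ := Finset.exists_min_image Finset.univ (fun i => ‖(x : ℂ) - t i‖)
      Finset.univ_nonempty
    have hi' : ‖(x : ℂ) - t i‖ ^ d ≤ |x ^ d + ∑ i, c i * x ^ (i : ℕ)| := by
      rw [hprod]
      calc ‖(x : ℂ) - t i‖ ^ d = ∏ j : Fin d, ‖(x : ℂ) - t i‖ := by simp
        _ ≤ _ := Finset.prod_le_prod (fun _ _ => norm_nonneg _) fun j _ => hi j (Finset.mem_univ j)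
    by_cases him : (t i).im = 0
    · left
      have hre : t i = ((t i).re : ℂ) := Complex.ext rfl (by simpa using him)
      refine ⟨(t i).re, ?_, ?_⟩
      · have := hroot i
        rw [hre] at this
        exact_mod_cast this
      · rw [hre, ← Complex.ofReal_sub, Complex.norm_real, Real.norm_eq_abs] at hi'
        exact hi'
    · right
      have hconj : ∏ j, ((starRingEnd ℂ) (t i) - t j) = 0 := by
        rw [← hev]
        have := congrArg (starRingEnd ℂ) (hroot i)
        simpa using this
      obtain ⟨j, -, hj⟩ := Finset.prod_eq_zero_iff.1 hconj
      have hj' : t j = (starRingEnd ℂ) (t i) := (sub_eq_zero.1 hj).symm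
      have hne : t i - t j ≠ 0 := by
        rw [hj', Complex.sub_conj]
        simpa using him
      have h1 := norm_sum_powersetCard_prod_le (fun p : Fin d × Fin d => t p.1 - t p.2) hB1
        (fun p => (norm_sub_le _ _).trans (by linarith [hle p.1, hle p.2])) (m := m)
        (fun k hk => by rw [← hQ k c t ht, hm k hk, Complex.ofReal_zero]) (i := (i, j)) hne
      rw [← hQ m c t ht, Complex.norm_real, Real.norm_eq_abs] at h1
      have h2 : ‖t i - t j‖ ≤ 2 * ‖(x : ℂ) - t i‖ := by
        have e : (starRingEnd ℂ) ((x : ℂ) - t i) = x - t j := by simp [hj']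
        have e' : ‖(x : ℂ) - t j‖ = ‖(x : ℂ) - t i‖ := by rw [← e, Complex.norm_conj]
        calc ‖t i - t j‖ = ‖((x : ℂ) - t j) - (x - t i)‖ := by congr 1; ring
          _ ≤ ‖(x : ℂ) - t j‖ + ‖(x : ℂ) - t i‖ := norm_sub_le _ _
          _ = _ := by rw [e']; ring
      calc |MvPolynomial.eval c (Q m)| ^ d
          ≤ (2 * ‖(x : ℂ) - t i‖ * B ^ Fintype.card (Fin d × Fin d)) ^ d := by
            gcongr
            exact h1.trans (by gcongr)
        _ = (2 * B ^ Fintype.card (Fin d × Fin d)) ^ d * ‖(x : ℂ) - t i‖ ^ d := by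
            rw [← mul_pow]; ring
        _ ≤ _ := by gcongr

end

/-- The algebra of real power series with absolutely summable coefficients. -/
def summableSeriesSubalgebra : Subalgebra ℝ (PowerSeries ℝ) where
  carrier := {p | Summable fun n => ‖PowerSeries.coeff n p‖}
  mul_mem' := by
    intro p q hp hq
    simpa only [Set.mem_ofPred_eq, PowerSeries.coeff_mul] using
      summable_norm_sum_mul_antidiagonal_of_summable_norm hp hq
  add_mem' := by
    intro p q hp hq
    simp only [Set.mem_ofPred_eq] at hp hq ⊢
    refine Summable.of_nonneg_of_le (fun _ => norm_nonneg _) (fun n => ?_) (hp.add hq)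
    rw [map_add]
    exact norm_add_le _ _
  algebraMap_mem' := by
    intro r
    refine summable_of_ne_finset_zero (s := {0}) fun n hn => ?_
    have : n ≠ 0 := by simpa using hn
    rw [PowerSeries.algebraMap_apply, PowerSeries.coeff_C, if_neg this, norm_zero]

/-- The Wiener algebra of real power series with absolutely summable coefficients, equipped
with the `ℓ¹` norm of the coefficients. -/
def SummableSeries : Type := summableSeriesSubalgebra

namespace SummableSeries

instance : CommRing SummableSeries := inferInstanceAs (CommRing summableSeriesSubalgebra)

instance : Algebra ℝ SummableSeries := inferInstanceAs (Algebra ℝ summableSeriesSubalgebra)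

/-- The inclusion into formal power series. -/
def toPowerSeries : SummableSeries →ₐ[ℝ] PowerSeries ℝ := summableSeriesSubalgebra.val

/-- The coefficients of a series. -/
def coeff (n : ℕ) (p : SummableSeries) : ℝ := PowerSeries.coeff n (toPowerSeries p)

theorem summable (p : SummableSeries) : Summable fun n => ‖coeff n p‖ := p.2

/-- The series with prescribed summable coefficients. -/
def mk (a : ℕ → ℝ) (ha : Summable fun n => ‖a n‖) : SummableSeries :=
  ⟨PowerSeries.mk a, by simpa [summableSeriesSubalgebra] using ha⟩

@[simp] theorem coeff_mk (a : ℕ → ℝ) (ha : Summable fun n => ‖a n‖) (n : ℕ) :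
    coeff n (mk a ha) = a n := PowerSeries.coeff_mk n a

@[ext] theorem ext {p q : SummableSeries} (h : ∀ n, coeff n p = coeff n q) : p = q :=
  Subtype.ext (PowerSeries.ext h)

@[simp] theorem coeff_zero (n : ℕ) : coeff n 0 = 0 := by simp [coeff]

@[simp] theorem coeff_add (n : ℕ) (p q : SummableSeries) :
    coeff n (p + q) = coeff n p + coeff n q := by simp [coeff]

@[simp] theorem coeff_neg (n : ℕ) (p : SummableSeries) : coeff n (-p) = -coeff n p := by
  simp [coeff]

@[simp] theorem coeff_sub (n : ℕ) (p q : SummableSeries) :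
    coeff n (p - q) = coeff n p - coeff n q := by simp [coeff]

@[simp] theorem coeff_smul (n : ℕ) (r : ℝ) (p : SummableSeries) :
    coeff n (r • p) = r * coeff n p := by simp [coeff]

theorem coeff_mul (n : ℕ) (p q : SummableSeries) :
    coeff n (p * q) = ∑ x ∈ Finset.HasAntidiagonal.antidiagonal n, coeff x.1 p * coeff x.2 q := by
  simp [coeff, PowerSeries.coeff_mul]

theorem coeff_one (n : ℕ) : coeff n 1 = if n = 0 then 1 else 0 := by
  simp [coeff, PowerSeries.coeff_one]

/-- The `ℓ¹` norm. -/
def ringNorm : RingNorm SummableSeries where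
  toFun p := ∑' n, ‖coeff n p‖
  map_zero' := by simp
  neg' p := by simp
  add_le' p q := by
    rw [← (summable p).tsum_add (summable q)]
    refine Summable.tsum_le_tsum (fun n => ?_) (summable _) ((summable p).add (summable q))
    rw [coeff_add]
    exact norm_add_le _ _
  mul_le' p q := by
    rw [tsum_mul_tsum_eq_tsum_sum_antidiagonal_of_summable_norm
      (by simpa using summable p) (by simpa using summable q)]
    have h := summable_norm_sum_mul_antidiagonal_of_summable_norm
      (f := fun n => ‖coeff n p‖) (g := fun n => ‖coeff n q‖)
      (by simpa using summable p) (by simpa using summable q)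
    refine Summable.tsum_le_tsum (fun n => ?_) (summable _) h.of_norm
    rw [coeff_mul]
    refine (norm_sum_le _ _).trans (le_of_eq ?_)
    simp
  eq_zero_of_map_eq_zero' p hp := by
    ext n
    have := (summable p).hasSum_iff.2 hp
    have h := (hasSum_zero_iff_of_nonneg fun n => norm_nonneg (coeff n p)).1 this
    simpa using congrFun h n

instance : NormedCommRing SummableSeries :=
  { ringNorm.toNormedRing with mul_comm := mul_comm }

theorem norm_def (p : SummableSeries) : ‖p‖ = ∑' n, ‖coeff n p‖ := rfl

instance : NormedAlgebra ℝ SummableSeries where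
  norm_smul_le r p := by
    simp [norm_def, tsum_mul_left]

instance : NormOneClass SummableSeries where
  norm_one := by
    rw [norm_def, tsum_eq_single 0] <;> simp +contextual [coeff_one]

theorem norm_coeff_le (n : ℕ) (p : SummableSeries) : ‖coeff n p‖ ≤ ‖p‖ :=
  (summable p).le_tsum n fun _ _ => norm_nonneg _

/-- The isometry with `ℓ¹`. -/
def toLp : SummableSeries ≃ₗᵢ[ℝ] lp (fun _ : ℕ => ℝ) 1 where
  toFun p := ⟨fun n => coeff n p, (memℓp_gen_iff (by simp)).2 (by simpa using summable p)⟩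
  invFun a := mk a (by simpa using (memℓp_gen_iff (by simp)).1 (lp.memℓp a))
  left_inv p := by ext n; simp
  right_inv a := by ext n; simp
  map_add' p q := by ext n; exact coeff_add n p q
  map_smul' r p := by ext n; exact coeff_smul n r p
  norm_map' p := by
    rw [lp.norm_eq_tsum_rpow (by simp)]
    simp [norm_def]

instance : CompleteSpace SummableSeries :=
  (completeSpace_congr (e := toLp.toEquiv) toLp.isometry.isUniformEmbedding).2 inferInstance

/-- Evaluation at a point of `[-1, 1]`. -/
def eval (x : ℝ) (hx : |x| ≤ 1) : SummableSeries →ₐ[ℝ] ℝ :=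
  have hs : ∀ p : SummableSeries, Summable fun n => ‖coeff n p * x ^ n‖ := fun p => by
    refine Summable.of_nonneg_of_le (fun _ => norm_nonneg _) (fun n => ?_) (summable p)
    rw [norm_mul, norm_pow]
    exact mul_le_of_le_one_right (norm_nonneg _) (pow_le_one₀ (norm_nonneg _) hx)
  AlgHom.ofLinearMap
    { toFun := fun p => ∑' n, coeff n p * x ^ n
      map_add' := fun p q => by
        rw [← (hs p).of_norm.tsum_add (hs q).of_norm]
        simp [add_mul]
      map_smul' := fun r p => by
        simp [mul_assoc, tsum_mul_left] }
    (by
      simp only [LinearMap.coe_mk, AddHom.coe_mk]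
      rw [tsum_eq_single 0] <;> simp +contextual [coeff_one])
    (fun p q => by
      simp only [LinearMap.coe_mk, AddHom.coe_mk]
      rw [tsum_mul_tsum_eq_tsum_sum_antidiagonal_of_summable_norm (hs p) (hs q)]
      refine tsum_congr fun n => ?_
      rw [coeff_mul, Finset.sum_mul]
      refine Finset.sum_congr rfl fun y hy => ?_
      rw [← Finset.HasAntidiagonal.mem_antidiagonal.1 hy, pow_add]
      ring)

theorem eval_apply {x : ℝ} (hx : |x| ≤ 1) (p : SummableSeries) :
    eval x hx p = ∑' n, coeff n p * x ^ n := rfl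

theorem norm_eval_le {x : ℝ} (hx : |x| ≤ 1) (p : SummableSeries) : ‖eval x hx p‖ ≤ ‖p‖ := by
  have h : ∀ n, ‖coeff n p * x ^ n‖ ≤ ‖coeff n p‖ := fun n => by
    rw [norm_mul, norm_pow]
    exact mul_le_of_le_one_right (norm_nonneg _) (pow_le_one₀ (norm_nonneg _) hx)
  exact tsum_of_norm_bounded (summable p).hasSum h

/-- The indeterminate. -/
def X : SummableSeries := mk (fun n => if n = 1 then 1 else 0)
  (summable_of_ne_finset_zero (s := {1}) (by simp +contextual))

theorem coeff_X_pow (d n : ℕ) : coeff n (X ^ d) = if n = d then 1 else 0 := by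
  have : toPowerSeries X = PowerSeries.X := by
    ext n
    change coeff n X = _
    rw [X, coeff_mk, PowerSeries.coeff_X]
  rw [coeff, map_pow, this, PowerSeries.coeff_X_pow]

theorem norm_X : ‖X‖ = 1 := by
  rw [norm_def, tsum_eq_single 1] <;> simp +contextual [X]

@[simp] theorem eval_X {x : ℝ} (hx : |x| ≤ 1) : eval x hx X = x := by
  rw [eval_apply, tsum_eq_single 1] <;> simp +contextual [X]

/-- The coefficient functionals. -/
def coeffCLM (n : ℕ) : SummableSeries →L[ℝ] ℝ :=
  LinearMap.mkContinuous
    { toFun := coeff n, map_add' := coeff_add n, map_smul' := fun r p => by simp } 1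
    fun p => by simpa using norm_coeff_le n p

theorem coeffCLM_apply (n : ℕ) (p : SummableSeries) : coeffCLM n p = coeff n p := rfl

/-- The quotient of a series by `X ^ d`, forgetting the terms of degree smaller than `d`. -/
def shift (d : ℕ) (p : SummableSeries) : SummableSeries :=
  mk (fun n => coeff (n + d) p) ((summable_nat_add_iff d).2 (summable p))

theorem coeff_mul_X_pow (p : SummableSeries) (d n : ℕ) :
    coeff n (p * X ^ d) = if d ≤ n then coeff (n - d) p else 0 := by
  have : toPowerSeries X = PowerSeries.X := by
    ext n
    change coeff n X = _
    rw [X, coeff_mk, PowerSeries.coeff_X]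
  rw [coeff, map_mul, map_pow, this, PowerSeries.coeff_mul_X_pow']
  rfl

/-- Division with remainder by `X ^ d`. -/
theorem shift_mul_X_pow_add (d : ℕ) (p : SummableSeries) :
    shift d p * X ^ d + ∑ i : Fin d, coeff i p • X ^ (i : ℕ) = p := by
  have hsum : ∀ n, coeff n (∑ i : Fin d, coeff i p • X ^ (i : ℕ)) =
      if n < d then coeff n p else 0 := fun n => by
    change coeffCLM n _ = _
    rw [map_sum]
    change ∑ i : Fin d, coeff n (coeff i p • X ^ (i : ℕ)) = _
    simp only [coeff_smul, coeff_X_pow, mul_ite, mul_one, mul_zero]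
    rw [Fin.sum_univ_eq_sum_range (fun i => if n = i then coeff i p else 0)]
    simp
  ext n
  rw [coeff_add, coeff_mul_X_pow, hsum]
  rcases lt_or_ge n d with h | h
  · simp [h]
  · simp [h, shift]

theorem eq_zero_of_mul_X_pow_add_eq_zero {d : ℕ} {p : SummableSeries} {c : Fin d → ℝ}
    (h : p * X ^ d + ∑ i : Fin d, c i • X ^ (i : ℕ) = 0) : p = 0 ∧ c = 0 := by
  have hsum : ∀ n, coeff n (∑ i : Fin d, c i • X ^ (i : ℕ)) =
      ∑ i : Fin d, if n = i then c i else 0 := fun n => by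
    change coeffCLM n _ = _
    rw [map_sum]
    change ∑ i : Fin d, coeff n (c i • X ^ (i : ℕ)) = _
    simp [coeff_X_pow]
  constructor
  · ext n
    have := congrArg (coeff (n + d)) h
    rw [coeff_add, coeff_mul_X_pow, hsum, Finset.sum_eq_zero] at this
    · simpa using this
    · intro i _
      rw [if_neg (by omega)]
  · ext i
    have := congrArg (coeff i) h
    rw [coeff_add, coeff_mul_X_pow, hsum, if_neg (by omega)] at this
    simpa [Fin.val_inj] using this

end SummableSeries

/-- The power series obtained from a real power series by substituting elements of a
commutative Banach algebra for the coordinates along a family of vectors. -/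
def FormalMultilinearSeries.baseChange {E ι : Type*} [NormedAddCommGroup E] [NormedSpace ℝ E]
    [Fintype ι] (p : FormalMultilinearSeries ℝ E ℝ) (b : ι → E) (A : Type*) [NormedCommRing A]
    [NormedAlgebra ℝ A] : FormalMultilinearSeries ℝ (ι → A) A := fun k =>
  ∑ i : Fin k → ι, p k (fun j => b (i j)) •
    (ContinuousMultilinearMap.mkPiAlgebra ℝ (Fin k) A).compContinuousLinearMap
      fun j => ContinuousLinearMap.proj (i j)

section BaseChange

variable {E ι : Type*} [NormedAddCommGroup E] [NormedSpace ℝ E] [Fintype ι]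
  {A : Type*} [NormedCommRing A] [NormedAlgebra ℝ A]

theorem FormalMultilinearSeries.baseChange_apply (p : FormalMultilinearSeries ℝ E ℝ) (b : ι → E)
    (k : ℕ) (a : ι → A) :
    p.baseChange b A k (fun _ => a) =
      ∑ i : Fin k → ι, p k (fun j => b (i j)) • ∏ j, a (i j) := by
  simp [FormalMultilinearSeries.baseChange]

theorem FormalMultilinearSeries.map_baseChange_apply (p : FormalMultilinearSeries ℝ E ℝ)
    (b : ι → E) (k : ℕ) (a : ι → A) (φ : A →ₐ[ℝ] ℝ) :
    φ (p.baseChange b A k fun _ => a) = p k fun _ => ∑ i, φ (a i) • b i := by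
  classical
  rw [p.baseChange_apply, map_sum]
  have := (p k).toMultilinearMap.map_sum (fun (_ : Fin k) (i : ι) => φ (a i) • b i)
  simp only [ContinuousMultilinearMap.coe_coe] at this
  rw [this]
  refine Finset.sum_congr rfl fun i _ => ?_
  rw [(p k).map_smul_univ, map_smul, map_prod, smul_eq_mul, smul_eq_mul, mul_comm]

theorem ContinuousMultilinearMap.norm_mkPiAlgebra_compContinuousLinearMap_proj_le [NormOneClass A]
    {k : ℕ} (i : Fin k → ι) :
    ‖(ContinuousMultilinearMap.mkPiAlgebra ℝ (Fin k) A).compContinuousLinearMap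
      fun j => ContinuousLinearMap.proj (R := ℝ) (φ := fun _ : ι => A) (i j)‖ ≤ 1 := by
  refine ContinuousMultilinearMap.opNorm_le_bound zero_le_one fun m => ?_
  rw [ContinuousMultilinearMap.compContinuousLinearMap_apply,
    ContinuousMultilinearMap.mkPiAlgebra_apply, one_mul]
  refine (Finset.norm_prod_le _ _).trans ?_
  exact Finset.prod_le_prod (fun _ _ => norm_nonneg _) fun j _ => norm_le_pi_norm (m j) (i j)

theorem FormalMultilinearSeries.norm_baseChange_le [NormOneClass A]
    (p : FormalMultilinearSeries ℝ E ℝ) (b : ι → E) (k : ℕ) :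
    ‖p.baseChange b A k‖ ≤ ‖p k‖ * (∑ i, ‖b i‖) ^ k := by
  classical
  rw [FormalMultilinearSeries.baseChange]
  have hterm : ∀ i : Fin k → ι, ‖p k (fun j => b (i j)) •
      (ContinuousMultilinearMap.mkPiAlgebra ℝ (Fin k) A).compContinuousLinearMap
        fun j => ContinuousLinearMap.proj (R := ℝ) (φ := fun _ : ι => A) (i j)‖ ≤
      ‖p k‖ * ∏ j, ‖b (i j)‖ := fun i => by
    rw [norm_smul]
    exact (mul_le_of_le_one_right (norm_nonneg _)
      (ContinuousMultilinearMap.norm_mkPiAlgebra_compContinuousLinearMap_proj_le i)).trans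
        ((p k).le_opNorm _)
  refine (norm_sum_le _ _).trans ((Finset.sum_le_sum fun i _ => hterm i).trans (le_of_eq ?_))
  rw [← Finset.mul_sum, ← Fin.prod_const, Finset.prod_univ_sum, Fintype.piFinset_univ]

theorem FormalMultilinearSeries.radius_baseChange_pos [NormOneClass A]
    (p : FormalMultilinearSeries ℝ E ℝ) (b : ι → E) (hp : 0 < p.radius) :
    0 < (p.baseChange b A).radius := by
  obtain ⟨C, r, hC, hr, hle⟩ := p.le_mul_pow_of_radius_pos hp
  set β : ℝ := ∑ i, ‖b i‖ with hβ
  have hβ0 : 0 ≤ β := Finset.sum_nonneg fun _ _ => norm_nonneg _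
  have hbound : ∀ k, ‖p.baseChange b A k‖ ≤ C * (r * β) ^ k := fun k => by
    refine (p.norm_baseChange_le b k).trans ?_
    rw [mul_pow, ← mul_assoc]
    gcongr
    exact hle k
  have hpos : 0 < (r * β + 1)⁻¹ := by positivity
  refine lt_of_lt_of_le ?_ ((p.baseChange b A).le_radius_of_bound C
    (r := ⟨(r * β + 1)⁻¹, hpos.le⟩) fun k => ?_)
  · exact ENNReal.coe_pos.2 (show (0 : NNReal) < ⟨(r * β + 1)⁻¹, hpos.le⟩ from hpos)
  · calc ‖p.baseChange b A k‖ * ((r * β + 1)⁻¹) ^ k ≤ C * (r * β) ^ k * ((r * β + 1)⁻¹) ^ k := by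
          gcongr; exact hbound k
      _ = C * ((r * β) / (r * β + 1)) ^ k := by rw [mul_assoc, ← mul_pow, div_eq_mul_inv]
      _ ≤ C * 1 := by
          gcongr
          refine pow_le_one₀ (by positivity) ?_
          rw [div_le_one (by positivity)]
          linarith
      _ = C := mul_one C

/-- A real analytic function extends to an analytic function on a power of a commutative Banach
algebra, compatibly with characters. -/
theorem HasFPowerSeriesAt.exists_baseChange [CompleteSpace A] [NormOneClass A] {f : E → ℝ}
    {p : FormalMultilinearSeries ℝ E ℝ} (hf : HasFPowerSeriesAt f p 0) (b : ι → E) :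
    ∃ (F : (ι → A) → A), ∃ R > (0 : ℝ), ∀ a : ι → A, ‖a‖ < R → AnalyticAt ℝ F a ∧
      HasSum (fun k => p.baseChange b A k fun _ => a) (F a) ∧
      ∀ φ : A →ₐ[ℝ] ℝ, (∀ x, ‖φ x‖ ≤ ‖x‖) → φ (F a) = f (∑ i, φ (a i) • b i) := by
  obtain ⟨r, hr⟩ := hf
  have hrad := p.radius_baseChange_pos (A := A) b (hr.r_pos.trans_le hr.r_le)
  have hball := (p.baseChange b A).hasFPowerSeriesOnBall hrad
  obtain ⟨R₁, hR₁, hR₁'⟩ := ENNReal.lt_iff_exists_nnreal_btwn.1 hrad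
  obtain ⟨R₂, hR₂, hR₂'⟩ := ENNReal.lt_iff_exists_nnreal_btwn.1 hr.r_pos
  have hR₁0 : (0 : ℝ) < R₁ := by exact_mod_cast hR₁
  have hR₂0 : (0 : ℝ) < R₂ := by exact_mod_cast hR₂
  set β : ℝ := ∑ i, ‖b i‖ with hβ
  have hβ0 : 0 ≤ β := Finset.sum_nonneg fun _ _ => norm_nonneg _
  refine ⟨(p.baseChange b A).sum, min R₁ (R₂ / (β + 1)), lt_min hR₁0 (by positivity), ?_⟩
  intro a ha
  have ha₁ : a ∈ Metric.eball (0 : ι → A) (p.baseChange b A).radius := by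
    rw [mem_eball_zero_iff]
    refine lt_trans ?_ hR₁'
    have : ‖a‖ < R₁ := ha.trans_le (min_le_left _ _)
    rw [enorm_eq_nnnorm]
    exact_mod_cast this
  have hsum := hball.hasSum ha₁
  rw [zero_add] at hsum
  refine ⟨hball.analyticAt_of_mem ha₁, hsum, fun φ hφ => ?_⟩
  have hmem : ∑ i, φ (a i) • b i ∈ Metric.eball (0 : E) r := by
    rw [mem_eball_zero_iff]
    refine lt_trans ?_ hR₂'
    have : ‖∑ i, φ (a i) • b i‖ < R₂ := by
      calc ‖∑ i, φ (a i) • b i‖ ≤ ∑ i, ‖φ (a i) • b i‖ := norm_sum_le _ _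
        _ ≤ ∑ i, ‖a‖ * ‖b i‖ := by
            refine Finset.sum_le_sum fun i _ => ?_
            rw [norm_smul]
            gcongr
            exact (hφ _).trans (norm_le_pi_norm a i)
        _ = ‖a‖ * β := by rw [← Finset.mul_sum]
        _ ≤ R₂ / (β + 1) * β := by
            gcongr
            exact (ha.trans_le (min_le_right _ _)).le
        _ < R₂ := by
            rw [div_mul_eq_mul_div, div_lt_iff₀ (by positivity)]
            nlinarith
    rw [enorm_eq_nnnorm]
    exact_mod_cast this
  have hsum' := hr.hasSum hmem
  rw [zero_add] at hsum'
  have hcont : Continuous φ := AddMonoidHomClass.continuous_of_bound φ 1 fun x => by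
    simpa using hφ x
  have := hsum.map φ hcont
  simp only [Function.comp_def, p.map_baseChange_apply] at this
  exact this.unique hsum'

end BaseChange

namespace SummableSeries

/-- Near `u₀ * X ^ d` with `u₀` a unit, every series factors analytically as the product of a
series and a monic polynomial of degree `d`. -/
theorem exists_local_factorization {u₀ : SummableSeries} (hu : IsUnit u₀) (d : ℕ) :
    ∃ (U : SummableSeries → SummableSeries) (c : SummableSeries → Fin d → ℝ),
      ContinuousAt U (u₀ * X ^ d) ∧ U (u₀ * X ^ d) = u₀ ∧
      AnalyticAt ℝ c (u₀ * X ^ d) ∧ c (u₀ * X ^ d) = 0 ∧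
      ∀ᶠ p in 𝓝 (u₀ * X ^ d), U p * (X ^ d + ∑ i, c p i • X ^ (i : ℕ)) = p := by
  let L : (Fin d → ℝ) →L[ℝ] SummableSeries :=
    ∑ i : Fin d, (ContinuousLinearMap.proj (R := ℝ) (φ := fun _ => ℝ) i).smulRight (X ^ (i : ℕ))
  have hL : ∀ c, L c = ∑ i, c i • X ^ (i : ℕ) := fun c => by
    simp [L]
  let Φ : SummableSeries × (Fin d → ℝ) → SummableSeries := fun q => q.1 * (X ^ d + L q.2)
  have hΦ0 : Φ (u₀, 0) = u₀ * X ^ d := by simp [Φ]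
  have hsmooth : ContDiffAt ℝ (⊤ : WithTop ℕ∞) Φ (u₀, 0) := by
    refine ContDiff.contDiffAt (contDiff_fst.mul (contDiff_const.add ?_))
    exact L.contDiff.comp contDiff_snd
  let Φ' : SummableSeries × (Fin d → ℝ) →L[ℝ] SummableSeries :=
    (ContinuousLinearMap.mul ℝ SummableSeries).flip (X ^ d) ∘L ContinuousLinearMap.fst ℝ _ _ +
      ContinuousLinearMap.mul ℝ SummableSeries u₀ ∘L L ∘L ContinuousLinearMap.snd ℝ _ _
  have hΦ'_apply : ∀ q, Φ' q = q.1 * X ^ d + u₀ * L q.2 := fun q => rfl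
  have hderiv : HasFDerivAt Φ Φ' (u₀, 0) := by
    have h1 : HasFDerivAt (fun q : SummableSeries × (Fin d → ℝ) => q.1)
      (ContinuousLinearMap.fst ℝ _ _) (u₀, 0) := hasFDerivAt_fst
    have h2 : HasFDerivAt (fun q : SummableSeries × (Fin d → ℝ) => X ^ d + L q.2)
      (L ∘L ContinuousLinearMap.snd ℝ _ _) (u₀, 0) :=
      HasFDerivAt.const_add (X ^ d) (L.hasFDerivAt.comp (u₀, (0 : Fin d → ℝ)) hasFDerivAt_snd)
    refine (h1.mul h2).congr_fderiv ?_
    ext q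
    · simp [hΦ'_apply, mul_comm]
    · simp [hΦ'_apply, mul_comm]
  have hinj : Function.Injective Φ' := by
    rw [injective_iff_map_eq_zero]
    rintro ⟨v, c⟩ h
    obtain ⟨w, rfl⟩ := hu
    rw [hΦ'_apply, hL] at h
    have h' : (↑w⁻¹ * v) * X ^ d + ∑ i : Fin d, c i • X ^ (i : ℕ) = 0 := by
      have := congrArg (fun x => (↑w⁻¹ : SummableSeries) * x) h
      simpa [mul_add, mul_assoc] using this
    obtain ⟨h1, rfl⟩ := eq_zero_of_mul_X_pow_add_eq_zero h'
    have : v = 0 := by simpa using congrArg (fun x => (w : SummableSeries) * x) h1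
    simp [this]
  have hsurj : Function.Surjective Φ' := by
    intro p
    obtain ⟨w, rfl⟩ := hu
    refine ⟨(w * shift d (↑w⁻¹ * p), fun i => coeff i (↑w⁻¹ * p)), ?_⟩
    rw [hΦ'_apply, hL, mul_assoc, ← mul_add, shift_mul_X_pow_add]
    simp
  let e : (SummableSeries × (Fin d → ℝ)) ≃L[ℝ] SummableSeries :=
    ContinuousLinearEquiv.ofBijective Φ' (LinearMap.ker_eq_bot.2 hinj)
      (LinearMap.range_eq_top.2 hsurj)
  have he : HasFDerivAt Φ (e : (SummableSeries × (Fin d → ℝ)) →L[ℝ] SummableSeries) (u₀, 0) := by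
    have : (e : (SummableSeries × (Fin d → ℝ)) →L[ℝ] SummableSeries) = Φ' := by ext <;> rfl
    rwa [this]
  have hne : (⊤ : WithTop ℕ∞) ≠ 0 := by simp
  have hstrict := hsmooth.hasStrictFDerivAt' he (by simp)
  set Ψ := hsmooth.localInverse he hne with hΨ
  have hΨa : AnalyticAt ℝ Ψ (u₀ * X ^ d) := by
    have := (hsmooth.to_localInverse he hne).analyticAt
    rwa [hΦ0] at this
  have hΨ0 : Ψ (u₀ * X ^ d) = (u₀, 0) := by
    have := hsmooth.localInverse_apply_image he hne
    rwa [hΦ0] at this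
  have hright : ∀ᶠ p in 𝓝 (u₀ * X ^ d), Φ (Ψ p) = p := by
    have := hstrict.eventually_right_inverse
    rwa [hΦ0] at this
  refine ⟨fun p => (Ψ p).1, fun p => (Ψ p).2, hΨa.continuousAt.fst, congrArg Prod.fst hΨ0,
    analyticAt_snd.comp hΨa, congrArg Prod.snd hΨ0, ?_⟩
  filter_upwards [hright] with p hp
  rwa [← hL]

theorem isUnit_of_norm_sub_smul_one_lt {u : SummableSeries} {κ : ℝ} (h : ‖u - κ • 1‖ < |κ|) :
    IsUnit u := by
  have hκ : κ ≠ 0 := by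
    rintro rfl
    simp only [abs_zero] at h
    exact absurd h (norm_nonneg _).not_gt
  have h1 : ‖1 - κ⁻¹ • u‖ < 1 := by
    have : 1 - κ⁻¹ • u = -(κ⁻¹ • (u - κ • 1)) := by
      rw [smul_sub, inv_smul_smul₀ hκ]
      abel
    rw [this, norm_neg, norm_smul, norm_inv, Real.norm_eq_abs, inv_mul_lt_iff₀ (abs_pos.2 hκ)]
    simpa using h
  have h2 := isUnit_one_sub_of_norm_lt_one h1
  rw [sub_sub_cancel] at h2
  have h3 := h2.smul (Units.mk0 κ hκ)
  rwa [Units.smul_def, Units.val_mk0, smul_inv_smul₀ hκ] at h3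

/-- Rescaling the variable of a series by a small factor makes the leading term dominant. -/
theorem norm_shift_sub_smul_one_le {p q : SummableSeries} {d : ℕ} {θ : ℝ} (hθ : 0 ≤ θ)
    (hθ' : θ ≤ 1) (h : ∀ k, coeff k q = θ ^ k * coeff k p) :
    ‖shift d q - (θ ^ d * coeff d p) • 1‖ ≤ θ ^ (d + 1) * ‖p‖ := by
  rw [norm_def, norm_def, ← tsum_mul_left]
  refine (Summable.tsum_le_tsum (f := fun n => _) (g := fun n => θ ^ (d + 1) * ‖coeff (n + d) p‖)
    (fun n => ?_) (summable _) (((summable_nat_add_iff d).2 (summable p)).mul_left _)).trans ?_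
  · rw [coeff_sub, coeff_smul, coeff_one, shift, coeff_mk, h]
    rcases n with _ | n
    · simp only [zero_add, if_true, mul_one, sub_self, norm_zero]
      positivity
    · simp only [Nat.add_eq_zero_iff, one_ne_zero, and_false, if_false, mul_zero, sub_zero,
        norm_mul, norm_pow, Real.norm_of_nonneg hθ]
      exact mul_le_mul_of_nonneg_right (pow_le_pow_of_le_one hθ hθ' (by omega)) (norm_nonneg _)
  · rw [tsum_mul_left, tsum_mul_left]
    refine mul_le_mul_of_nonneg_left ?_ (by positivity)
    rw [← (summable p).sum_add_tsum_nat_add d]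
    exact le_add_of_nonneg_left (Finset.sum_nonneg fun _ _ => norm_nonneg _)

end SummableSeries

open SummableSeries in
/-- A weak form of the Weierstrass preparation theorem. -/
theorem AnalyticAt.exists_weierstrass_preparation {n : ℕ} {f : (Fin n → ℝ) × ℝ → ℝ}
    (hf : AnalyticAt ℝ f 0) (hne : ¬ ∀ᶠ t in 𝓝 (0 : ℝ), f (0, t) = 0) :
    ∃ (d : ℕ) (c : (Fin n → ℝ) → Fin d → ℝ) (u : (Fin n → ℝ) × ℝ → ℝ),
      AnalyticAt ℝ c 0 ∧ c 0 = 0 ∧ ∃ ε > 0, ∀ᶠ y in 𝓝 (0 : (Fin n → ℝ) × ℝ),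
        f y = u y * (y.2 ^ d + ∑ i, c y.1 i * y.2 ^ (i : ℕ)) ∧ ε ≤ |u y| := by
  classical
  obtain ⟨p, hp⟩ := hf
  set b : Option (Fin n) → (Fin n → ℝ) × ℝ :=
    fun o => o.elim (0, 1) fun i => (Pi.single i 1, 0) with hb
  obtain ⟨F, R, hR, hF⟩ := hp.exists_baseChange (A := SummableSeries) b
  set a : ℝ → (Fin n → ℝ) → Option (Fin n) → SummableSeries :=
    fun s y o => o.elim (s • X) fun i => algebraMap ℝ SummableSeries (y i) with ha
  have ha_norm : ∀ s, 0 ≤ s → s < R → ‖a s 0‖ < R := fun s hs hsR => by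
    rw [pi_norm_lt_iff hR]
    rintro (_ | i)
    · simpa [ha, norm_smul, norm_X, abs_of_nonneg hs] using hsR
    · simpa [ha] using hR
  have hcoeff : ∀ s, 0 ≤ s → s < R → ∀ k,
      coeff k (F (a s 0)) = s ^ k * p k fun _ => (0, 1) := fun s hs hsR k => by
    have hsum := (hF _ (ha_norm s hs hsR)).2.1
    have hterm : ∀ j, p.baseChange b SummableSeries j (fun _ => a s 0) =
        (s ^ j * p j fun _ => (0, 1)) • X ^ j := fun j => by
      rw [p.baseChange_apply, Finset.sum_eq_single fun _ => none]
      · simp [ha, hb, smul_pow, smul_smul, mul_comm]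
      · intro i _ hi
        obtain ⟨l, hl⟩ := Function.ne_iff.1 hi
        obtain ⟨m, hm⟩ := Option.ne_none_iff_exists'.1 hl
        rw [Finset.prod_eq_zero (Finset.mem_univ l), smul_zero]
        simp [ha, hm]
      · simp
    simp only [hterm] at hsum
    have h1 := (coeffCLM k).hasSum hsum
    have h2 : HasSum (fun j => if j = k then (s ^ k * p k fun _ => ((0 : Fin n → ℝ), (1 : ℝ))) else 0)
        (s ^ k * p k fun _ => (0, 1)) := hasSum_ite_eq k _
    refine h1.unique ?_
    convert h2 using 2 with j
    rw [coeffCLM_apply, coeff_smul, coeff_X_pow]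
    rcases eq_or_ne j k with rfl | hjk
    · simp
    · simp [hjk, hjk.symm]
  obtain ⟨d, hd, hdmin⟩ : ∃ d, (p d fun _ => ((0 : Fin n → ℝ), (1 : ℝ))) ≠ 0 ∧
      ∀ k < d, (p k fun _ => ((0 : Fin n → ℝ), (1 : ℝ))) = 0 := by
    have : ∃ d, (p d fun _ => ((0 : Fin n → ℝ), (1 : ℝ))) ≠ 0 := by
      by_contra! hall
      refine hne ?_
      have htend : Tendsto (fun t : ℝ => ((0 : Fin n → ℝ), t)) (𝓝 0) (𝓝 0) :=
        (Continuous.prodMk_right (0 : Fin n → ℝ)).tendsto' 0 0 rfl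
      filter_upwards [htend.eventually hp.eventually_hasSum] with t ht
      have hzero : ∀ k, (p k fun _ => ((0 : Fin n → ℝ), t)) = 0 := fun k => by
        have : ((0 : Fin n → ℝ), t) = t • ((0 : Fin n → ℝ), (1 : ℝ)) := by simp
        rw [this, (p k).map_smul_univ (fun _ => t) fun _ => ((0 : Fin n → ℝ), (1 : ℝ)), hall,
          smul_zero]
      simp only [hzero, zero_add] at ht
      exact ht.unique hasSum_zero
    exact ⟨Nat.find this, Nat.find_spec this, fun k hk => by simpa using Nat.find_min this hk⟩
  set v : ℝ := p d fun _ => ((0 : Fin n → ℝ), (1 : ℝ)) with hv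
  set P₀ := F (a (R / 2) 0) with hP₀
  set γ : ℝ := coeff d P₀ with hγ
  have hγ' : γ = (R / 2) ^ d * v := hcoeff _ (by positivity) (by linarith) d
  have hγ0 : 0 < |γ| := by
    rw [hγ', abs_pos]
    exact mul_ne_zero (by positivity) hd
  set θ : ℝ := |γ| / (|γ| + 4 * ‖P₀‖) with hθ
  have hden : 0 < |γ| + 4 * ‖P₀‖ := by positivity
  have hθ0 : 0 < θ := by positivity
  have hθ1 : θ ≤ 1 := (div_le_one hden).2 (by linarith [norm_nonneg P₀])
  have hθP : θ * ‖P₀‖ ≤ |γ| / 4 := by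
    rw [hθ, div_mul_eq_mul_div, div_le_iff₀ hden]
    nlinarith [norm_nonneg P₀]
  set s : ℝ := θ * (R / 2) with hs
  have hs0 : 0 < s := by positivity
  have hsR : s < R := by
    have : s ≤ 1 * (R / 2) := mul_le_mul_of_nonneg_right hθ1 (by positivity)
    linarith
  set Q := F (a s 0) with hQ
  have hQcoeff : ∀ k, coeff k Q = θ ^ k * coeff k P₀ := fun k => by
    rw [hQ, hcoeff s hs0.le hsR, hP₀, hcoeff _ (by positivity) (by linarith), hs, mul_pow, mul_assoc]
  set κ : ℝ := θ ^ d * γ with hκ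
  have hκ0 : 0 < |κ| := by
    rw [hκ, abs_mul, abs_of_pos (pow_pos hθ0 d)]
    positivity
  set u₀ := shift d Q with hu₀
  have hu₀κ : ‖u₀ - κ • 1‖ ≤ |κ| / 4 := by
    refine (norm_shift_sub_smul_one_le hθ0.le hθ1 hQcoeff).trans ?_
    rw [pow_succ, mul_assoc, hκ, abs_mul, abs_of_pos (pow_pos hθ0 d), mul_div_assoc]
    gcongr
  have hQ_eq : Q = u₀ * X ^ d := by
    conv_lhs => rw [← shift_mul_X_pow_add d Q]
    rw [Finset.sum_eq_zero, add_zero]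
    intro i _
    rw [hQ, hcoeff s hs0.le hsR, hdmin i i.2, mul_zero, zero_smul]
  obtain ⟨U, c, hU, hU0, hc, hc0, hUc⟩ :=
    exists_local_factorization (isUnit_of_norm_sub_smul_one_lt (hu₀κ.trans_lt (by linarith))) d
  rw [← hQ_eq] at hU hU0 hc hc0 hUc
  have ha_an : AnalyticAt ℝ (a s) 0 := by
    rw [analyticAt_pi_iff]
    rintro (_ | i)
    · exact analyticAt_const
    · exact ((Algebra.linearMap ℝ SummableSeries).toContinuousLinearMap ∘L
        ContinuousLinearMap.proj (R := ℝ) (φ := fun _ : Fin n => ℝ) i).analyticAt 0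
  set g : (Fin n → ℝ) → SummableSeries := fun y => F (a s y) with hg
  have hg_an : AnalyticAt ℝ g 0 := AnalyticAt.comp (hF _ (ha_norm s hs0.le hsR)).1 ha_an
  have hg0 : g 0 = Q := rfl
  rw [← hg0] at hU hU0 hc hc0 hUc
  set c' : (Fin n → ℝ) → Fin d → ℝ := fun y i => s ^ (d - (i : ℕ)) * c (g y) i with hc'
  set u : (Fin n → ℝ) × ℝ → ℝ := fun y =>
    if h : |y.2 / s| ≤ 1 then (s ^ d)⁻¹ * eval (y.2 / s) h (U (g y.1)) else 0 with hu
  have hsd : 0 < s ^ d := pow_pos hs0 d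
  refine ⟨d, c', u, ?_, ?_, (s ^ d)⁻¹ * (|κ| / 2), by positivity, ?_⟩
  · rw [analyticAt_pi_iff]
    intro i
    exact analyticAt_const.mul ((analyticAt_pi_iff.1 (hc.comp hg_an)) i)
  · ext i
    simp [hc', hc0]
  have h1 : ∀ᶠ y in 𝓝 (0 : Fin n → ℝ), ‖a s y‖ < R :=
    (ha_an.continuousAt.norm).eventually_lt_const (ha_norm s hs0.le hsR)
  have h2 : ∀ᶠ y in 𝓝 (0 : Fin n → ℝ),
      U (g y) * (X ^ d + ∑ i, c (g y) i • X ^ (i : ℕ)) = g y :=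
    hg_an.continuousAt.eventually hUc
  have h3 : ∀ᶠ y in 𝓝 (0 : Fin n → ℝ), ‖U (g y) - κ • 1‖ < |κ| / 2 := by
    have : ContinuousAt (fun y => ‖U (g y) - κ • 1‖) 0 :=
      ((ContinuousAt.comp (f := g) hU hg_an.continuousAt).sub continuousAt_const).norm
    refine this.eventually_lt_const ?_
    change ‖U (g 0) - κ • 1‖ < |κ| / 2
    rw [hU0]
    linarith
  have h4 : ∀ᶠ t in 𝓝 (0 : ℝ), |t / s| ≤ 1 := by
    have : ContinuousAt (fun t : ℝ => |t / s|) 0 := by fun_prop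
    filter_upwards [this.eventually_lt_const (u := 1) (by simp)] with t ht using ht.le
  have hfst : Tendsto (Prod.fst : (Fin n → ℝ) × ℝ → _) (𝓝 0) (𝓝 0) :=
    continuous_fst.tendsto' _ _ rfl
  have hsnd : Tendsto (Prod.snd : (Fin n → ℝ) × ℝ → _) (𝓝 0) (𝓝 0) :=
    continuous_snd.tendsto' _ _ rfl
  filter_upwards [hfst.eventually h1, hfst.eventually h2, hfst.eventually h3, hsnd.eventually h4]
    with y hy1 hy2 hy3 hy4
  have huy : u y = (s ^ d)⁻¹ * eval (y.2 / s) hy4 (U (g y.1)) := dif_pos hy4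
  have hev : |eval (y.2 / s) hy4 (U (g y.1)) - κ| ≤ |κ| / 2 := by
    have := (norm_eval_le hy4 (U (g y.1) - κ • 1)).trans hy3.le
    simpa using this
  refine ⟨?_, ?_⟩
  · have hval := (hF _ hy1).2.2 (eval (y.2 / s) hy4) (norm_eval_le hy4)
    have harg : ∑ o, eval (y.2 / s) hy4 (a s y.1 o) • b o = y := by
      rw [Fintype.sum_option]
      refine Prod.ext ?_ ?_
      · simp [ha, hb, Prod.fst_sum, ← Pi.single_smul, Finset.univ_sum_single]
      · simp [ha, hb, Prod.snd_sum, mul_div_cancel₀ _ hs0.ne']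
    rw [harg] at hval
    rw [← hval, huy]
    change eval (y.2 / s) hy4 (g y.1) = _
    conv_lhs => rw [← hy2]
    rw [map_mul, mul_comm (s ^ d)⁻¹, mul_assoc]
    congr 1
    rw [map_add, map_sum, map_pow, eval_X, mul_add, Finset.mul_sum]
    congr 1
    · rw [div_pow]; field_simp
    · refine Finset.sum_congr rfl fun i _ => ?_
      rw [map_smul, map_pow, eval_X, hc', smul_eq_mul, div_pow]
      have : s ^ d = s ^ (d - (i : ℕ)) * s ^ (i : ℕ) := by
        rw [← pow_add, Nat.sub_add_cancel i.2.le]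
      rw [this]
      field_simp
  · rw [huy, abs_mul (s ^ d)⁻¹, abs_of_pos (inv_pos.2 hsd)]
    have := abs_sub_abs_le_abs_sub κ (eval (y.2 / s) hy4 (U (g y.1)))
    rw [abs_sub_comm] at this
    gcongr
    linarith

/-- Some positive power of `a` is dominated by `b` along the filter `l`. -/
def IsPowBigO {α : Type*} (l : Filter α) (a b : α → ℝ) : Prop :=
  ∃ N : ℕ, N ≠ 0 ∧ (fun x => a x ^ N) =O[l] b

section IsPowBigO

variable {α : Type*} {l l' : Filter α} {a a' b b' : α → ℝ}

theorem Asymptotics.IsBigO.isPowBigO (h : a =O[l] b) : IsPowBigO l a b :=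
  ⟨1, one_ne_zero, by simpa using h⟩

theorem IsPowBigO.trans (h : IsPowBigO l a b) (h' : IsPowBigO l b b') : IsPowBigO l a b' := by
  obtain ⟨N, hN, hab⟩ := h
  obtain ⟨M, hM, hbc⟩ := h'
  refine ⟨N * M, mul_ne_zero hN hM, ?_⟩
  simpa only [pow_mul] using (hab.pow M).trans hbc

theorem IsPowBigO.mono (h : IsPowBigO l a b) (hl : l' ≤ l) : IsPowBigO l' a b :=
  let ⟨N, hN, hab⟩ := h
  ⟨N, hN, hab.mono hl⟩

theorem IsPowBigO.comp_tendsto {β : Type*} {k : Filter β} {φ : β → α} (h : IsPowBigO l a b)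
    (hφ : Tendsto φ k l) : IsPowBigO k (fun x => a (φ x)) fun x => b (φ x) :=
  let ⟨N, hN, hab⟩ := h
  ⟨N, hN, hab.comp_tendsto hφ⟩

theorem isPowBigO_of_eventually_abs_pow_le {N : ℕ} (hN : N ≠ 0) {C : ℝ}
    (h : ∀ᶠ x in l, |a x| ^ N ≤ C * |b x|) : IsPowBigO l a b :=
  ⟨N, hN, IsBigO.of_bound C (h.mono fun x hx => by simpa using hx)⟩

theorem IsPowBigO.sup (h : IsPowBigO l a b) (h' : IsPowBigO l' a b)
    (hb : b =O[l ⊔ l'] (1 : α → ℝ)) : IsPowBigO (l ⊔ l') a b := by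
  obtain ⟨N, hN, hab⟩ := h
  obtain ⟨M, hM, hab'⟩ := h'
  have key : ∀ k ≠ 0, ∀ j ≠ 0, ∀ l'' ≤ l ⊔ l', (fun x => a x ^ k) =O[l''] b →
      (fun x => a x ^ (k * j)) =O[l''] b := by
    intro k _ j hj l'' hl h
    obtain ⟨i, rfl⟩ := Nat.exists_eq_succ_of_ne_zero hj
    have h1 := (h.pow i).trans ((hb.mono hl).pow i)
    simpa [pow_mul, pow_succ] using h1.mul h
  refine ⟨N * M, mul_ne_zero hN hM, IsBigO.sup (key N hN M hM l le_sup_left hab) ?_⟩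
  rw [mul_comm]
  exact key M hM N hN l' le_sup_right hab'

theorem IsPowBigO.add (h : IsPowBigO l a b) (h' : IsPowBigO l a' b)
    (hb : b =O[l] (1 : α → ℝ)) : IsPowBigO l (fun x => a x + a' x) b := by
  set S : Set α := {x | |a' x| ≤ |a x|} with hS
  have hl : l ⊓ 𝓟 S ⊔ l ⊓ 𝓟 Sᶜ = l := by
    rw [← inf_sup_left, sup_principal, Set.union_compl_self, principal_univ, inf_top_eq]
  rw [← hl]
  refine IsPowBigO.sup ?_ ?_ (by rwa [hl])
  · refine IsPowBigO.trans (IsBigO.isPowBigO (IsBigO.of_bound 2 ?_)) (h.mono inf_le_left)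
    filter_upwards [mem_inf_of_right (mem_principal_self S)] with x hx
    have : |a' x| ≤ |a x| := hx
    calc |a x + a' x| ≤ |a x| + |a' x| := abs_add_le _ _
      _ ≤ 2 * |a x| := by linarith
  · refine IsPowBigO.trans (IsBigO.isPowBigO (IsBigO.of_bound 2 ?_)) (h'.mono inf_le_left)
    filter_upwards [mem_inf_of_right (mem_principal_self Sᶜ)] with x hx
    have : ¬ |a' x| ≤ |a x| := hx
    calc |a x + a' x| ≤ |a x| + |a' x| := abs_add_le _ _
      _ ≤ 2 * |a' x| := by linarith

theorem IsPowBigO.tendsto_zero (h : IsPowBigO l a b) (hb : Tendsto b l (𝓝 0)) :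
    Tendsto a l (𝓝 0) := by
  obtain ⟨N, -, hab⟩ := h
  have h1 := hab.trans_tendsto hb
  rw [Metric.tendsto_nhds] at h1 ⊢
  intro ε hε
  filter_upwards [h1 (ε ^ N) (pow_pos hε N)] with x hx
  rw [dist_zero_right, norm_pow] at hx
  rw [dist_zero_right]
  exact lt_of_pow_lt_pow_left₀ N hε.le hx

end IsPowBigO

/-- Along `l`, points have zeros of `f` at a distance some power of which is dominated by `η`. -/
def HasNearbyZeros {E : Type*} [NormedAddCommGroup E] (l : Filter E) (f η : E → ℝ) : Prop :=
  ∃ z : E → E, (∀ᶠ y in l, f (z y) = 0) ∧ IsPowBigO l (fun y => ‖z y - y‖) η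

section HasNearbyZeros

variable {E : Type*} [NormedAddCommGroup E] {l : Filter E} {f η η' : E → ℝ}

theorem HasNearbyZeros.trans (h : HasNearbyZeros l f η) (h' : IsPowBigO l η η') :
    HasNearbyZeros l f η' :=
  let ⟨z, hz, hzη⟩ := h
  ⟨z, hz, hzη.trans h'⟩

theorem HasNearbyZeros.mono {l' : Filter E} (h : HasNearbyZeros l f η) (hl : l' ≤ l) :
    HasNearbyZeros l' f η :=
  let ⟨z, hz, hzη⟩ := h
  ⟨z, hz.filter_mono hl, hzη.mono hl⟩

theorem HasNearbyZeros.of_inf_principal_compl (S : Set E)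
    (h : HasNearbyZeros (l ⊓ 𝓟 S) f η) (h' : HasNearbyZeros (l ⊓ 𝓟 Sᶜ) f η)
    (hη : η =O[l] (1 : E → ℝ)) : HasNearbyZeros l f η := by
  classical
  obtain ⟨z, hz, hzη⟩ := h
  obtain ⟨z', hz', hzη'⟩ := h'
  have hl : l ⊓ 𝓟 S ⊔ l ⊓ 𝓟 Sᶜ = l := by
    rw [← inf_sup_left, sup_principal, Set.union_compl_self, principal_univ, inf_top_eq]
  have hS : S.piecewise z z' =ᶠ[l ⊓ 𝓟 S] z :=
    mem_inf_of_right fun y hy => S.piecewise_eq_of_mem z z' hy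
  have hS' : S.piecewise z z' =ᶠ[l ⊓ 𝓟 Sᶜ] z' :=
    mem_inf_of_right fun y hy => S.piecewise_eq_of_notMem z z' hy
  rw [← hl] at hη ⊢
  refine ⟨S.piecewise z z', eventually_sup.2 ⟨?_, ?_⟩, IsPowBigO.sup ?_ ?_ hη⟩
  · filter_upwards [hz, hS] with y hy hy'
    rwa [hy']
  · filter_upwards [hz', hS'] with y hy hy'
    rwa [hy']
  · refine (IsBigO.isPowBigO (EventuallyEq.isBigO ?_)).trans hzη
    filter_upwards [hS] with y hy
    rw [hy]
  · refine (IsBigO.isPowBigO (EventuallyEq.isBigO ?_)).trans hzη'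
    filter_upwards [hS'] with y hy
    rw [hy]

theorem hasNearbyZeros_of_eventually_le_abs (hl : l ≤ 𝓝 0) (h0 : f 0 = 0) {ε : ℝ} (hε : 0 < ε)
    (h : ∀ᶠ y in l, ε ≤ |η y|) : HasNearbyZeros l f η := by
  refine ⟨fun _ => 0, Eventually.of_forall fun _ => h0, IsBigO.isPowBigO ?_⟩
  have h1 : (fun y : E => ‖0 - y‖) =O[l] (1 : E → ℝ) := by
    have : Tendsto (fun y : E => ‖0 - y‖) (𝓝 0) (𝓝 0) :=
      Continuous.tendsto' (by fun_prop) _ _ (by simp)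
    exact (this.mono_left hl).isBigO_one ℝ
  refine h1.trans (IsBigO.of_bound ε⁻¹ ?_)
  filter_upwards [h] with y hy
  rw [Pi.one_apply, norm_one, Real.norm_eq_abs, ← div_eq_inv_mul, le_div_iff₀ hε, one_mul]
  exact hy

theorem hasNearbyZeros_of_eventually_eq_zero (h : ∀ᶠ y in l, f y = 0) :
    HasNearbyZeros l f η :=
  ⟨id, h, IsBigO.isPowBigO (by simpa using isBigO_zero η l)⟩

end HasNearbyZeros

theorem HasNearbyZeros.of_continuousLinearEquiv {E F : Type*} [NormedAddCommGroup E]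
    [NormedSpace ℝ E] [NormedAddCommGroup F] [NormedSpace ℝ F] (A : E ≃L[ℝ] F) {f : F → ℝ}
    (h : HasNearbyZeros (𝓝 0) (f ∘ A) (f ∘ A)) : HasNearbyZeros (𝓝 0) f f := by
  obtain ⟨z, hz, hzf⟩ := h
  have htend : Tendsto A.symm (𝓝 0) (𝓝 0) := A.symm.continuous.tendsto' _ _ (map_zero _)
  refine ⟨fun y => A (z (A.symm y)), htend.eventually hz, ?_⟩
  have h1 := hzf.comp_tendsto htend
  simp only [Function.comp_apply, A.apply_symm_apply] at h1
  refine (IsBigO.isPowBigO (IsBigO.of_bound ‖(A : E →L[ℝ] F)‖ ?_)).trans h1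
  filter_upwards with y
  have := (A : E →L[ℝ] F).le_opNorm (z (A.symm y) - A.symm y)
  simpa using this

theorem AnalyticAt.isBigO_comp_sub {α E F : Type*} [NormedAddCommGroup E] [NormedSpace ℝ E]
    [NormedAddCommGroup F] [NormedSpace ℝ F] [CompleteSpace F] {f : E → F} {x : E}
    (hf : AnalyticAt ℝ f x) {l : Filter α} {u v : α → E} (hu : Tendsto u l (𝓝 x))
    (hv : Tendsto v l (𝓝 x)) : (fun a => f (u a) - f (v a)) =O[l] fun a => u a - v a :=
  hf.hasStrictFDerivAt.isBigO_sub.comp_tendsto (hu.prodMk_nhds hv)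

theorem AnalyticAt.monic_polynomial {n d : ℕ} {c : (Fin n → ℝ) → Fin d → ℝ}
    (hc : AnalyticAt ℝ c 0) :
    AnalyticAt ℝ (fun y : (Fin n → ℝ) × ℝ => y.2 ^ d + ∑ i, c y.1 i * y.2 ^ (i : ℕ)) 0 := by
  refine (analyticAt_snd.pow d).add (Finset.analyticAt_fun_sum _ fun i _ => ?_)
  exact ((analyticAt_pi_iff.1 hc i).comp_of_eq analyticAt_fst rfl).mul (analyticAt_snd.pow _)

/-- The inductive step: zeros of a monic polynomial with analytic coefficients are nearby, provided
this holds for analytic functions of the coefficient variables. -/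
theorem hasNearbyZeros_monic_polynomial {n d : ℕ} {c : (Fin n → ℝ) → Fin d → ℝ}
    (ih : ∀ f : (Fin n → ℝ) → ℝ, AnalyticAt ℝ f 0 → f 0 = 0 → HasNearbyZeros (𝓝 0) f f)
    (hd : d ≠ 0) (hc : AnalyticAt ℝ c 0) (hc0 : c 0 = 0) :
    HasNearbyZeros (𝓝 0) (fun y : (Fin n → ℝ) × ℝ => y.2 ^ d + ∑ i, c y.1 i * y.2 ^ (i : ℕ))
      fun y => y.2 ^ d + ∑ i, c y.1 i * y.2 ^ (i : ℕ) := by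
  obtain ⟨E, M, K, hE0, hEM, hE⟩ := exists_invariants_real_root d
  set P : (Fin n → ℝ) × ℝ → ℝ := fun y => y.2 ^ d + ∑ i, c y.1 i * y.2 ^ (i : ℕ) with hP
  set e : ℕ → (Fin n → ℝ) → ℝ := fun j y => MvPolynomial.eval (c y) (E j) with he
  have he_an : ∀ j, AnalyticAt ℝ (e j) 0 := fun j => by
    have := AnalyticAt.aeval_mvPolynomial (f := c) (fun i => analyticAt_pi_iff.1 hc i) (E j)
    simpa [MvPolynomial.aeval_eq_eval] using this
  have hP0 : P 0 = 0 := by simp [hP, hc0, hd]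
  have hP_an : AnalyticAt ℝ P 0 := hc.monic_polynomial
  set H : ℕ → (Fin n → ℝ) → ℝ := fun m y => ∑ j ∈ Finset.Ico m (M + 1), e j y ^ 2 with hH
  have hH_an : ∀ m, AnalyticAt ℝ (H m) 0 := fun m =>
    Finset.analyticAt_fun_sum _ fun j _ => (he_an j).pow 2
  have hH_nonneg : ∀ m y, 0 ≤ H m y := fun m y => Finset.sum_nonneg fun j _ => sq_nonneg _
  have hfst : Tendsto (Prod.fst : (Fin n → ℝ) × ℝ → _) (𝓝 0) (𝓝 0) :=
    continuous_fst.tendsto' _ _ rfl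
  have hsnd : Tendsto (Prod.snd : (Fin n → ℝ) × ℝ → _) (𝓝 0) (𝓝 0) :=
    continuous_snd.tendsto' _ _ rfl
  set η : ℕ → (Fin n → ℝ) × ℝ → ℝ := fun m y => |P y| + H m y.1 with hη
  have hη_nonneg : ∀ m y, 0 ≤ η m y := fun m y => add_nonneg (abs_nonneg _) (hH_nonneg _ _)
  have hη_cont : ∀ m, ContinuousAt (η m) 0 := fun m =>
    hP_an.continuousAt.abs.add ((hH_an m).continuousAt.tendsto.comp hfst)
  have hη_one : ∀ m, η m =O[𝓝 0] (1 : (Fin n → ℝ) × ℝ → ℝ) := fun m =>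
    (hη_cont m).tendsto.isBigO_one ℝ
  have hle : ∀ {a : (Fin n → ℝ) × ℝ → ℝ} {m}, (∀ y, |a y| ≤ η m y) → a =O[𝓝 0] η m :=
    fun h => IsBigO.of_bound 1 (Eventually.of_forall fun y => by
      rw [one_mul]
      exact (h y).trans (le_abs_self _))
  have hHη : ∀ m, (fun y : (Fin n → ℝ) × ℝ => H m y.1) =O[𝓝 0] η m := fun m => hle fun y => by
    rw [abs_of_nonneg (hH_nonneg _ _)]
    exact le_add_of_nonneg_left (abs_nonneg _)
  have hPη : ∀ m, P =O[𝓝 0] η m := fun m => hle fun y => le_add_of_nonneg_right (hH_nonneg _ _)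
  have claim : ∀ m ≤ M + 1, HasNearbyZeros (𝓝 0) P (η m) := by
    intro m
    induction m with
    | zero =>
      refine fun _ => hasNearbyZeros_of_eventually_le_abs le_rfl hP0 one_pos
        (Eventually.of_forall fun y => ?_)
      rw [abs_of_nonneg (hη_nonneg _ _)]
      have h1 : e 0 y.1 ^ 2 ≤ H 0 y.1 :=
        Finset.single_le_sum (f := fun j => e j y.1 ^ 2) (fun j _ => sq_nonneg _) (by simp)
      have h2 : e 0 y.1 = 1 := hE0 _
      rw [h2] at h1
      have : η 0 y = |P y| + H 0 y.1 := rfl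
      linarith [abs_nonneg (P y)]
    | succ m hm =>
      intro hmM
      have hHm : ∀ y, H m y = e m y ^ 2 + H (m + 1) y := fun y =>
        Finset.sum_eq_sum_Ico_succ_bot (by omega) _
      rcases eq_or_ne (H (m + 1) 0) 0 with hG0 | hG0
      swap
      · have hpos : 0 < H (m + 1) 0 := lt_of_le_of_ne (hH_nonneg _ _) hG0.symm
        refine hasNearbyZeros_of_eventually_le_abs le_rfl hP0 (half_pos hpos) ?_
        have := (hH_an (m + 1)).continuousAt.eventually_const_lt (half_lt_self hpos)
        filter_upwards [hfst.eventually this] with y hy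
        rw [abs_of_nonneg (hη_nonneg _ _)]
        have h' : η (m + 1) y = |P y| + H (m + 1) y.1 := rfl
        linarith [abs_nonneg (P y)]
      obtain ⟨w, hw, hwG⟩ := ih (H (m + 1)) (hH_an _) hG0
      have hw' : ∀ᶠ y : (Fin n → ℝ) × ℝ in 𝓝 0, H (m + 1) (w y.1) = 0 := hfst.eventually hw
      have hδ : IsPowBigO (𝓝 0) (fun y : (Fin n → ℝ) × ℝ => ‖w y.1 - y.1‖) (η (m + 1)) :=
        (hwG.comp_tendsto hfst).trans (hHη _).isPowBigO
      have hw0 : Tendsto (fun y : (Fin n → ℝ) × ℝ => w y.1) (𝓝 0) (𝓝 0) := by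
        have h1 := hwG.tendsto_zero (by simpa [hG0] using (hH_an (m + 1)).continuousAt.tendsto)
        have h2 := (tendsto_zero_iff_norm_tendsto_zero.2 h1).add tendsto_id
        simp only [id, sub_add_cancel, add_zero] at h2
        exact h2.comp hfst
      have hu0 : Tendsto (fun y : (Fin n → ℝ) × ℝ => (w y.1, y.2)) (𝓝 0) (𝓝 0) :=
        hw0.prodMk_nhds hsnd
      set Q : (Fin n → ℝ) × ℝ → ℝ := fun y => P (w y.1, y.2) with hQ
      have hQη : IsPowBigO (𝓝 0) Q (η (m + 1)) := by
        have h1 : (fun y => Q y - P y) =O[𝓝 0] fun y : (Fin n → ℝ) × ℝ => ‖w y.1 - y.1‖ := by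
          refine (hP_an.isBigO_comp_sub hu0 tendsto_id).trans (IsBigO.of_bound 1 ?_)
          filter_upwards with y
          simp [Prod.norm_def]
        simpa using (h1.isPowBigO.trans hδ).add (hPη (m + 1)).isPowBigO (hη_one _)
      set S : Set ((Fin n → ℝ) × ℝ) := {y | ∃ ζ : ℝ,
        ζ ^ d + ∑ i, c (w y.1) i * ζ ^ (i : ℕ) = 0 ∧ |y.2 - ζ| ^ d ≤ |Q y|} with hS
      refine HasNearbyZeros.of_inf_principal_compl S ?_ ?_ (hη_one _)
      · choose! ζ hζ hζ' using fun (y : (Fin n → ℝ) × ℝ) (hy : y ∈ S) => hy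
        have hmem : ∀ᶠ y in 𝓝 0 ⊓ 𝓟 S, y ∈ S := mem_inf_of_right (mem_principal_self S)
        refine ⟨fun y => (w y.1, ζ y), hmem.mono hζ, ?_⟩
        have h1 : IsPowBigO (𝓝 0 ⊓ 𝓟 S) (fun y => |y.2 - ζ y|) Q :=
          isPowBigO_of_eventually_abs_pow_le hd (C := 1) (hmem.mono fun y hy => by
            simpa using hζ' y hy)
        have h2 := (hδ.mono inf_le_left).add (h1.trans (hQη.mono inf_le_left))
          ((hη_one _).mono inf_le_left)
        refine IsPowBigO.trans (IsBigO.isPowBigO (IsBigO.of_bound 1 ?_)) h2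
        filter_upwards with y
        rw [norm_norm, one_mul, Prod.norm_def,
          Real.norm_of_nonneg (add_nonneg (norm_nonneg _) (abs_nonneg _))]
        refine max_le (le_add_of_nonneg_right (abs_nonneg _)) ?_
        rw [abs_sub_comm]
        exact le_add_of_nonneg_left (norm_nonneg _)
      · refine ((hm (by omega)).mono inf_le_left).trans ?_
        have hev : ∀ᶠ y in 𝓝 0 ⊓ 𝓟 Sᶜ, |e m (w y.1)| ^ d ≤ K * |Q y| := by
          have hsmall : ∀ᶠ y : (Fin n → ℝ) × ℝ in 𝓝 0, ‖c (w y.1)‖ < 1 := by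
            have : ContinuousAt (fun y => ‖c y‖) 0 := hc.continuousAt.norm
            exact hw0.eventually (this.eventually_lt_const (by simp [hc0]))
          filter_upwards [mem_inf_of_right (mem_principal_self Sᶜ), mem_inf_of_left hsmall,
            mem_inf_of_left hw'] with y hyS hy hyH
          refine (hE (c (w y.1)) (fun i => (norm_le_pi_norm _ i).trans (le_of_lt hy)) m ?_
            y.2).resolve_left hyS
          intro j hj
          rcases lt_or_ge M j with hjM | hjM
          · exact hEM _ j hjM
          · have := (Finset.sum_eq_zero_iff_of_nonneg fun j _ => sq_nonneg (e j (w y.1))).1 hyH j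
              (Finset.mem_Ico.2 ⟨hj, Nat.lt_succ_of_le hjM⟩)
            exact pow_eq_zero_iff two_ne_zero |>.1 this
        have h1 : IsPowBigO (𝓝 0 ⊓ 𝓟 Sᶜ) (fun y => e m (w y.1)) (η (m + 1)) :=
          (isPowBigO_of_eventually_abs_pow_le hd hev).trans (hQη.mono inf_le_left)
        have h2 : IsPowBigO (𝓝 0) (fun y : (Fin n → ℝ) × ℝ => e m y.1 - e m (w y.1))
            (η (m + 1)) := by
          refine IsPowBigO.trans (IsBigO.isPowBigO ?_) hδ
          have := (he_an m).isBigO_comp_sub hfst hw0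
          refine this.trans (IsBigO.of_bound 1 ?_)
          filter_upwards with y
          rw [one_mul, norm_norm, norm_sub_rev]
        have h3 : IsPowBigO (𝓝 0 ⊓ 𝓟 Sᶜ) (fun y : (Fin n → ℝ) × ℝ => e m y.1) (η (m + 1)) := by
          simpa using h1.add (h2.mono inf_le_left) ((hη_one _).mono inf_le_left)
        have h4 : IsPowBigO (𝓝 0 ⊓ 𝓟 Sᶜ) (fun y : (Fin n → ℝ) × ℝ => e m y.1 ^ 2)
            (η (m + 1)) := by
          refine IsPowBigO.trans (IsBigO.isPowBigO ?_) h3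
          have hone : (fun y : (Fin n → ℝ) × ℝ => e m y.1) =O[𝓝 0 ⊓ 𝓟 Sᶜ]
              (1 : (Fin n → ℝ) × ℝ → ℝ) :=
            (((he_an m).continuousAt.tendsto.comp hfst).isBigO_one ℝ).mono inf_le_left
          simpa [sq] using hone.mul (isBigO_refl (fun y : (Fin n → ℝ) × ℝ => e m y.1) _)
        have h5 := h4.add (isBigO_refl (η (m + 1)) _).isPowBigO ((hη_one _).mono inf_le_left)
        refine IsPowBigO.trans (IsBigO.isPowBigO (EventuallyEq.isBigO ?_)) h5
        filter_upwards with y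
        simp only [hη, hHm]
        ring
  refine (claim (M + 1) le_rfl).trans (IsBigO.isPowBigO (IsBigO.of_bound 1 ?_))
  filter_upwards with y
  simp [hη, hH]

theorem AnalyticAt.exists_not_eventually_eq_zero_smul {E : Type*} [NormedAddCommGroup E]
    [NormedSpace ℝ E] {f : E → ℝ} (hf : AnalyticAt ℝ f 0) (hne : ¬ ∀ᶠ y in 𝓝 0, f y = 0) :
    ∃ e, ¬ ∀ᶠ t in 𝓝 (0 : ℝ), f (t • e) = 0 := by
  by_contra! hall
  refine hne ?_
  obtain ⟨r, hr, hball⟩ := Metric.eventually_nhds_iff_ball.1 hf.eventually_analyticAt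
  filter_upwards [Metric.ball_mem_nhds 0 hr] with y hy
  have han : AnalyticOnNhd ℝ (fun t : ℝ => f (t • y)) (Set.Icc 0 1) := fun t ht => by
    refine AnalyticAt.comp (g := f) (f := fun t : ℝ => t • y) (hball _ ?_)
      (analyticAt_id.smul analyticAt_const)
    rw [mem_ball_zero_iff] at hy ⊢
    rw [norm_smul, Real.norm_of_nonneg ht.1]
    exact (mul_le_of_le_one_left (norm_nonneg _) ht.2).trans_lt hy
  simpa using han.eqOn_zero_of_preconnected_of_eventuallyEq_zero isPreconnected_Icc
    (Set.left_mem_Icc.2 zero_le_one) (hall y) (Set.right_mem_Icc.2 zero_le_one)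

/-- The local Łojasiewicz inequality at a zero of an analytic function. -/
theorem AnalyticAt.hasNearbyZeros {n : ℕ} {f : (Fin n → ℝ) → ℝ} (hf : AnalyticAt ℝ f 0)
    (h0 : f 0 = 0) : HasNearbyZeros (𝓝 0) f f := by
  induction n with
  | zero =>
    exact hasNearbyZeros_of_eventually_eq_zero
      (Eventually.of_forall fun y => by rw [Subsingleton.elim y 0, h0])
  | succ n ih =>
    by_cases hev : ∀ᶠ y in 𝓝 0, f y = 0
    · exact hasNearbyZeros_of_eventually_eq_zero hev
    obtain ⟨e, he⟩ := hf.exists_not_eventually_eq_zero_smul hev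
    have he0 : e ≠ 0 := by
      rintro rfl
      simp [h0] at he
    obtain ⟨A, hA⟩ : ∃ A : ((Fin n → ℝ) × ℝ) ≃L[ℝ] (Fin (n + 1) → ℝ), A (0, 1) = e := by
      let B : ((Fin n → ℝ) × ℝ) ≃L[ℝ] (Fin (n + 1) → ℝ) :=
        ContinuousLinearEquiv.ofFinrankEq (by simp)
      obtain ⟨A, hA⟩ := SeparatingDual.exists_continuousLinearEquiv_apply_eq (R := ℝ)
        (x := B (0, 1)) (y := e) (by simp) he0
      exact ⟨B.trans A, hA⟩
    refine HasNearbyZeros.of_continuousLinearEquiv A ?_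
    set g := f ∘ A with hg
    have hg_an : AnalyticAt ℝ g 0 :=
      AnalyticAt.comp (by rwa [map_zero]) ((A : ((Fin n → ℝ) × ℝ) →L[ℝ] (Fin (n + 1) → ℝ)).analyticAt 0)
    have hgne : ¬ ∀ᶠ t in 𝓝 (0 : ℝ), g (0, t) = 0 := by
      convert he using 5 with t
      rw [hg, Function.comp_apply, ← hA, ← map_smul]
      simp
    obtain ⟨d, c, u, hc, hc0, ε, hε, hprep⟩ := hg_an.exists_weierstrass_preparation hgne
    set P : (Fin n → ℝ) × ℝ → ℝ := fun y => y.2 ^ d + ∑ i, c y.1 i * y.2 ^ (i : ℕ) with hP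
    have hd : d ≠ 0 := by
      rintro rfl
      have h1 := hprep.self_of_nhds
      have h2 : g 0 = 0 := by simp [hg, h0]
      have h3 : u 0 = 0 := by simpa [h2] using h1.1.symm
      rw [h3, abs_zero] at h1
      exact absurd h1.2 hε.not_ge
    obtain ⟨z, hz, hzP⟩ := hasNearbyZeros_monic_polynomial (fun f => ih) hd hc hc0
    have hP_zero : Tendsto P (𝓝 0) (𝓝 0) := by
      have hPc : ContinuousAt P 0 := hc.monic_polynomial.continuousAt
      simpa [hP, hc0, hd] using hPc.tendsto
    have hz0 : Tendsto z (𝓝 0) (𝓝 0) := by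
      have h2 := (tendsto_zero_iff_norm_tendsto_zero.2 (hzP.tendsto_zero hP_zero)).add tendsto_id
      simpa using h2
    refine ⟨z, ?_, hzP.trans (IsBigO.isPowBigO (IsBigO.of_bound ε⁻¹ ?_))⟩
    · filter_upwards [hz, hz0.eventually hprep] with y hy hy'
      rw [hy'.1, hy, mul_zero]
    · filter_upwards [hprep] with y hy
      rw [← div_eq_inv_mul, le_div_iff₀ hε, hy.1, norm_mul, mul_comm]
      exact mul_le_mul_of_nonneg_right hy.2 (norm_nonneg _)

/-- The Łojasiewicz inequality near a point of the domain. -/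
theorem AnalyticAt.isPowBigO_infDist_zeros {n : ℕ} {V : Set (EuclideanSpace ℝ (Fin n))} (hV : IsOpen V)
    {f : EuclideanSpace ℝ (Fin n) → ℝ} {x : EuclideanSpace ℝ (Fin n)} (hf : AnalyticAt ℝ f x)
    (hx : x ∈ V) :
    IsPowBigO (𝓝 x) (fun y => Metric.infDist y {x | x ∈ V ∧ f x = 0}) f := by
  set Z : Set (EuclideanSpace ℝ (Fin n)) := {x | x ∈ V ∧ f x = 0} with hZ
  have hinf : ContinuousAt (fun y => Metric.infDist y Z) x :=
    (Metric.continuous_infDist_pt Z).continuousAt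
  rcases eq_or_ne (f x) 0 with h0 | h0
  swap
  · refine IsBigO.isPowBigO ((hinf.tendsto.isBigO_one ℝ).trans ?_)
    refine IsBigO.of_bound (2 / |f x|) ?_
    filter_upwards [hf.continuousAt.norm.eventually_const_lt (half_lt_self (norm_pos_iff.2 h0))]
      with y hy
    rw [norm_one, div_mul_eq_mul_div, le_div_iff₀ (abs_pos.2 h0)]
    rw [Real.norm_eq_abs] at hy
    linarith
  let A : EuclideanSpace ℝ (Fin n) ≃L[ℝ] (Fin n → ℝ) := EuclideanSpace.equiv (Fin n) ℝ
  set φ : (Fin n → ℝ) → EuclideanSpace ℝ (Fin n) := fun y => A.symm y + x with hφ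
  have hφ0 : φ 0 = x := by simp [hφ]
  have hφ_an : AnalyticAt ℝ φ 0 :=
    ((A.symm : (Fin n → ℝ) →L[ℝ] EuclideanSpace ℝ (Fin n)).analyticAt 0).add analyticAt_const
  have hg_an : AnalyticAt ℝ (f ∘ φ) 0 := AnalyticAt.comp (by rwa [hφ0]) hφ_an
  have hg0 : (f ∘ φ) 0 = 0 := by rw [Function.comp_apply, hφ0, h0]
  obtain ⟨z, hz, hzf⟩ := hg_an.hasNearbyZeros hg0
  have hz0 : Tendsto z (𝓝 0) (𝓝 0) := by
    have h1 : Tendsto (f ∘ φ) (𝓝 0) (𝓝 0) := by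
      have := hg_an.continuousAt.tendsto
      rwa [hg0] at this
    have h2 := (tendsto_zero_iff_norm_tendsto_zero.2 (hzf.tendsto_zero h1)).add tendsto_id
    simpa using h2
  set ψ : EuclideanSpace ℝ (Fin n) → (Fin n → ℝ) := fun y => A (y - x) with hψ
  have hψ0 : Tendsto ψ (𝓝 x) (𝓝 0) :=
    Continuous.tendsto' (by fun_prop) _ _ (by simp [hψ])
  have hφψ : ∀ y, φ (ψ y) = y := fun y => by simp [hφ, hψ]
  have h1 := hzf.comp_tendsto hψ0
  simp only [Function.comp_apply, hφψ] at h1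
  refine IsPowBigO.trans (IsBigO.isPowBigO
    (IsBigO.of_bound ‖(A.symm : (Fin n → ℝ) →L[ℝ] EuclideanSpace ℝ (Fin n))‖ ?_)) h1
  have hmem : ∀ᶠ y in 𝓝 x, φ (z (ψ y)) ∈ V := by
    have : Tendsto (fun y => φ (z (ψ y))) (𝓝 x) (𝓝 x) := by
      have h := hφ_an.continuousAt.tendsto
      rw [hφ0] at h
      exact h.comp (hz0.comp hψ0)
    exact this.eventually (hV.mem_nhds hx)
  filter_upwards [hmem, hψ0.eventually hz] with y hyV hyz
  rw [Real.norm_of_nonneg Metric.infDist_nonneg, norm_norm]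
  have h2 : Metric.infDist y Z ≤ dist y (φ (z (ψ y))) := Metric.infDist_le_dist_of_mem ⟨hyV, hyz⟩
  refine h2.trans ?_
  have h3 : φ (z (ψ y)) - y = A.symm (z (ψ y) - ψ y) := by
    simp only [hφ, hψ, map_sub, A.symm_apply_apply]
    abel
  rw [dist_comm, dist_eq_norm, h3]
  exact (A.symm : (Fin n → ℝ) →L[ℝ] EuclideanSpace ℝ (Fin n)).le_opNorm _

theorem IsCompact.isPowBigO_infDist_zeros {n : ℕ} {V K : Set (EuclideanSpace ℝ (Fin n))}
    (hK : IsCompact K) (hV : IsOpen V) {f : EuclideanSpace ℝ (Fin n) → ℝ}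
    (hf : AnalyticOnNhd ℝ f V) (hKV : K ⊆ V) :
    IsPowBigO (𝓟 K) (fun y => Metric.infDist y {x | x ∈ V ∧ f x = 0}) f := by
  have hbdd : f =O[𝓟 K] (1 : EuclideanSpace ℝ (Fin n) → ℝ) := by
    obtain ⟨C, hC⟩ := hK.exists_bound_of_continuousOn (hf.continuousOn.mono hKV)
    exact IsBigO.of_bound C (by simpa using hC)
  rw [← inf_idem (𝓟 K)]
  refine hK.induction_on (p := fun s => IsPowBigO (𝓟 s ⊓ 𝓟 K)
    (fun y => Metric.infDist y {x | x ∈ V ∧ f x = 0}) f) ?_ ?_ ?_ ?_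
  · rw [principal_empty, bot_inf_eq]
    exact IsBigO.isPowBigO (isBigO_bot _ _)
  · exact fun s t hst h => h.mono (inf_le_inf_right _ (principal_mono.2 hst))
  · intro s t hs ht
    rw [← sup_principal, inf_sup_right]
    exact hs.sup ht (hbdd.mono (sup_le inf_le_right inf_le_right))
  · intro x hx
    obtain ⟨N, hN, hle⟩ := (hf x (hKV hx)).isPowBigO_infDist_zeros hV (hKV hx)
    obtain ⟨C, hC⟩ := hle.bound
    exact ⟨_, mem_nhdsWithin_of_mem_nhds hC, N, hN,
      (IsBigO.of_bound C (mem_principal_self _)).mono inf_le_left⟩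

end

/-- Łojasiewicz inequality: if `f` is real-analytic on the open set `V ⊆ ℝⁿ`, `K ⊆ V` is
compact, and the zero set `Z = {x ∈ V | f x = 0}` is nonempty, then there are `C > 0` and
`r > 0` with `|f y| ≥ C · dist (y, Z) ^ r` for all `y ∈ K`. -/
theorem lojasiewicz_inequality {n : ℕ} (V : Set (EuclideanSpace ℝ (Fin n))) (hV : IsOpen V)
    (f : EuclideanSpace ℝ (Fin n) → ℝ) (hf : AnalyticOnNhd ℝ f V)
    (K : Set (EuclideanSpace ℝ (Fin n))) (hK : IsCompact K) (hKV : K ⊆ V)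
    (hZ : {x | x ∈ V ∧ f x = 0}.Nonempty) :
    ∃ C > (0:ℝ), ∃ r > (0:ℝ), ∀ y ∈ K,
      C * Metric.infDist y {x | x ∈ V ∧ f x = 0} ^ r ≤ |f y| := by
  obtain ⟨N, hN, hle⟩ := hK.isPowBigO_infDist_zeros hV hf hKV
  obtain ⟨C, hC, hle⟩ := hle.exists_pos
  refine ⟨C⁻¹, inv_pos.2 hC, N, by positivity, fun y hy => ?_⟩
  have := Asymptotics.isBigOWith_principal.1 hle y hy
  rw [Real.rpow_natCast, inv_mul_le_iff₀ hC]
  simpa [abs_of_nonneg (Metric.infDist_nonneg)] using this
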